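/- The symmetrization map β descends to the indicated quotients and induces a k-linear isomorphism ⊕_{d≥1} λ^(d)(𝔞) ≅ U𝔞 / (k·1 + [U𝔞, U𝔞]), i.e. the direct sum over d ≥ 1 of the coinvariant spaces λ^(d)(𝔞) = Sym^d(𝔞)/[𝔞, Sym^d(𝔞)] is isomorphic to the reduced cyclic space of the universal enveloping algebra U𝔞 (its quotient by the span of the unit together with all commutators). This is the Lie–Hodge decomposition of the reduced cyclic space of U𝔞, a consequence of the Poincaré–Birkhoff–Witt theorem. -/

import Mathlib

open scoped DirectSum

noncomputable section

variable (k : Type) [Field k] [CharZero k]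
variable (a : Type) [LieRing a] [LieAlgebra k a]

/-- The subspace `k·1 + [U𝔞, U𝔞]` of the universal enveloping algebra: the span of the unit
together with all commutators. -/
def redCycRel : Submodule k (UniversalEnvelopingAlgebra k a) :=
  Submodule.span k
    ({(1 : UniversalEnvelopingAlgebra k a)} ∪
      {z : UniversalEnvelopingAlgebra k a |
        ∃ u v : UniversalEnvelopingAlgebra k a, z = u * v - v * u})

/-- The reduced cyclic space `U𝔞 / (k·1 + [U𝔞, U𝔞])` of the universal enveloping algebra. -/
abbrev RedCyc : Type := UniversalEnvelopingAlgebra k a ⧸ redCycRel k a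

/-- The subspace of the `d`-th tensor power of (the underlying space of) `𝔞` spanned by the
symmetry relations; the quotient is the symmetric power `Sym^d(𝔞)`. -/
def symPowRel (d : ℕ) : Submodule k (PiTensorProduct k (fun _ : Fin d => a)) :=
  Submodule.span k
    { z | ∃ (x : Fin d → a) (σ : Equiv.Perm (Fin d)),
        z = PiTensorProduct.tprod k x - PiTensorProduct.tprod k (x ∘ σ) }

/-- The symmetric power `Sym^d(𝔞)`. -/
abbrev SymPow (d : ℕ) : Type := PiTensorProduct k (fun _ : Fin d => a) ⧸ symPowRel k a d

/-- The subspace `[𝔞, Sym^d(𝔞)]` of `Sym^d(𝔞)`: the span of the elements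
`Σ_j x₁⋯x_{j−1}[y,x_j]x_{j+1}⋯x_d`. -/
def adSub (d : ℕ) : Submodule k (SymPow k a d) :=
  Submodule.span k
    { z | ∃ (y : a) (x : Fin d → a),
        z = Submodule.Quotient.mk
          (∑ j : Fin d, PiTensorProduct.tprod k (Function.update x j ⁅y, x j⁆)) }

/-- The coinvariant space `λ^(d)(𝔞) = Sym^d(𝔞)/[𝔞, Sym^d(𝔞)]`. -/
abbrev LambdaD (d : ℕ) : Type := SymPow k a d ⧸ adSub k a d


section avg
variable {k E : Type*} [Field k] [CharZero k] [AddCommGroup E] [Module k E]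

/-- the partial products `s_j s_{j+1} ⋯ s_{m-1} w`, indexed by length `m - j` -/
def pbwW (s : ℕ → E →ₗ[k] E) (m : ℕ) : ℕ → E → E
  | 0, w => w
  | t + 1, w => s (m - (t + 1)) (pbwW s m t w)

theorem pbw_avg (s : ℕ → E →ₗ[k] E) (N : ℕ)
    (h1 : ∀ i, i < N → ∀ v, s i (s i v) = v)
    (h2 : ∀ i, i + 1 < N → ∀ v, s i (s (i+1) (s i v)) = s (i+1) (s i (s (i+1) v)))
    (h3 : ∀ i j, i + 1 < j → j < N → ∀ v, s i (s j v) = s j (s i v)) (v : E) :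
    ∀ m, m ≤ N → ∃ w, (∀ i, i < m → s i w = w) ∧
      (∀ P : Submodule k E, (∀ i, i < N → ∀ x ∈ P, s i x ∈ P) → v ∈ P → w ∈ P) ∧
      w - v ∈ Submodule.span k {z | ∃ i, i < N ∧ ∃ x, z = s i x - x} := by
  intro m
  induction m with
  | zero => exact fun _ => ⟨v, by simp, fun _ _ h => h, by simp⟩
  | succ m ih =>
    intro hm
    obtain ⟨w, hw, hP, hK⟩ := ih (by omega)
    -- p t = s_{m+1-t} ... s_m w, t = 0..m+1
    let p : ℕ → E := fun t => pbwW s (m+1) t w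
    have p0 : p 0 = w := rfl
    have ps : ∀ t, p (t+1) = s (m + 1 - (t+1)) (p t) := fun t => rfl
    -- lower commuting
    have hlow : ∀ t i, i + t < m → s i (p t) = p t := by
      intro t
      induction t with
      | zero => intro i hi; exact hw i (by omega)
      | succ t iht =>
        intro i hi
        rw [ps, h3 i _ (by omega) (by omega), iht i (by omega)]
    have hhigh : ∀ t i, t ≤ m + 1 → m + 1 < i + t → i ≤ m → s i (p t) = p t := by
      intro t
      induction t with
      | zero => intro i _ h1 h2; omega
      | succ t iht =>
        intro i ht hi him
        rw [ps]
        rcases Nat.lt_or_ge (m + 1) (i + t) with h | h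
        · have := h3 (m + 1 - (t+1)) i (by omega) (by omega) (p t)
          rw [← this, iht i (by omega) h him]
        · -- i = m+1-t
          obtain ⟨t, rfl⟩ : ∃ u, t = u + 1 := ⟨t - 1, by omega⟩
          obtain ⟨i, rfl⟩ : ∃ u, i = u + 1 := ⟨i - 1, by omega⟩
          have e1 : m + 1 - (t + 1 + 1) = i := by omega
          have e2 : m + 1 - (t + 1) = i + 1 := by omega
          rw [e1, ps, e2, ← h2 i (by omega), hlow t i (by omega)]
    have hmid1 : ∀ t, t ≤ m → s (m - t) (p t) = p (t+1) := by
      intro t ht; rw [ps]; congr 2; omega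
    have hmid2 : ∀ t, t ≤ m → s (m - t) (p (t+1)) = p t := by
      intro t ht
      rw [← hmid1 t ht, h1 _ (by omega)]
    have hsum : ∀ i, i < m + 1 → s i (∑ t ∈ Finset.range (m+2), p t) = ∑ t ∈ Finset.range (m+2), p t := by
      intro i hi
      rw [map_sum]
      refine Finset.sum_equiv (Equiv.swap (m - i) (m - i + 1)) ?_ ?_
      · intro t
        simp only [Finset.mem_range, Equiv.swap_apply_def]
        split_ifs <;> omega
      · intro t ht
        simp only [Finset.mem_range] at ht
        rw [Equiv.swap_apply_def]
        split_ifs with h h'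
        · rw [h]; have := hmid1 (m - i) (by omega)
          rwa [show m - (m - i) = i by omega] at this
        · rw [h']; have := hmid2 (m - i) (by omega)
          rwa [show m - (m - i) = i by omega] at this
        · rcases Nat.lt_or_ge (i + t) m with h2 | h2
          · exact hlow t i h2
          · exact hhigh t i (by omega) (by omega) (by omega)
    have hne : ((m + 2 : ℕ) : k) ≠ 0 := by exact_mod_cast (by omega : m + 2 ≠ 0)
    refine ⟨((m + 2 : ℕ) : k)⁻¹ • ∑ t ∈ Finset.range (m+2), p t, ?_, ?_, ?_⟩
    · intro i hi
      rw [map_smul, hsum i hi]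
    · intro P hs hv
      refine P.smul_mem _ (P.sum_mem fun t ht => ?_)
      have : ∀ t, t ≤ m + 1 → p t ∈ P := by
        intro t
        induction t with
        | zero => intro _; exact hP P hs hv
        | succ t iht => intro ht; rw [ps]; exact hs _ (by omega) _ (iht (by omega))
      exact this t (by simp at ht; omega)
    · set K := Submodule.span k {z | ∃ i, i < N ∧ ∃ x, z = s i x - x} with hKd
      have : ∀ t, t ≤ m + 1 → p t - v ∈ K := by
        intro t
        induction t with
        | zero => intro _; exact hK
        | succ t iht =>
          intro ht
          have := K.add_mem (iht (by omega)) (Submodule.subset_span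
            ⟨m + 1 - (t+1), by omega, p t, rfl⟩ : s (m+1-(t+1)) (p t) - p t ∈ K)
          rw [ps]; convert this using 1; abel
      have e : ((m + 2 : ℕ) : k)⁻¹ • ∑ t ∈ Finset.range (m+2), p t - v
          = ((m + 2 : ℕ) : k)⁻¹ • ∑ t ∈ Finset.range (m+2), (p t - v) := by
        rw [Finset.sum_sub_distrib, smul_sub, Finset.sum_const, Finset.card_range,
          ← Nat.cast_smul_eq_nsmul k, smul_smul, inv_mul_cancel₀ hne, one_smul]
      rw [e]
      exact K.smul_mem _ (K.sum_mem fun t ht => this t (by simp at ht; omega))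
end avg

section pbwstep
set_option linter.unusedSectionVars false

/-- swap entries `i`, `i+1` of a sequence -/
def pbwS {L : Type*} (i : ℕ) (x : ℕ → L) : ℕ → L :=
  fun j => if j = i then x (i+1) else if j = i + 1 then x i else x j

/-- contract entries `i`, `i+1` of a sequence -/
def pbwC {L : Type*} [LieRing L] (i : ℕ) (x : ℕ → L) : ℕ → L :=
  fun j => if j < i then x j else if j = i then ⁅x i, x (i+1)⁆ else x (j+1)

/-- extension of a tuple by zero -/
def pbwExt {L : Type*} [Zero L] (n : ℕ) (x : Fin n → L) : ℕ → L :=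
  fun j => if h : j < n then x ⟨j, h⟩ else 0

/-- functions of sequences that are multilinear in the first `n` entries and ignore the rest -/
def pbwML (K L M : Type*) [Field K] [AddCommGroup L] [Module K L] [AddCommGroup M] [Module K M]
    (n : ℕ) : Submodule K ((ℕ → L) → M) where
  carrier := {f | (∀ x y, (∀ j, j < n → x j = y j) → f x = f y) ∧
    (∀ x j, j < n → ∀ u v, f (Function.update x j (u + v)) =
      f (Function.update x j u) + f (Function.update x j v)) ∧
    (∀ x j, j < n → ∀ (c : K) u, f (Function.update x j (c • u)) =
      c • f (Function.update x j u))}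
  zero_mem' := by simp
  add_mem' := by
    rintro f g ⟨h1, h2, h3⟩ ⟨h1', h2', h3'⟩
    refine ⟨fun x y h => ?_, fun x j hj u v => ?_, fun x j hj c u => ?_⟩
    · simp [h1 x y h, h1' x y h]
    · simp only [Pi.add_apply, h2 x j hj, h2' x j hj]; abel
    · simp only [Pi.add_apply, h3 x j hj, h3' x j hj, smul_add]
  smul_mem' := by
    rintro r f ⟨h1, h2, h3⟩
    refine ⟨fun x y h => ?_, fun x j hj u v => ?_, fun x j hj c u => ?_⟩
    · simp [h1 x y h]
    · simp only [Pi.smul_apply, h2 x j hj, smul_add]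
    · simp only [Pi.smul_apply, h3 x j hj, smul_comm r c]

variable {K L M : Type*} [Field K] [CharZero K] [LieRing L] [LieAlgebra K L]
  [AddCommGroup M] [Module K M]

theorem pbwS_S (i : ℕ) (x : ℕ → L) : pbwS i (pbwS i x) = x := by
  funext j; simp only [pbwS]; grind

theorem pbwC_S (i : ℕ) (x : ℕ → L) :
    pbwC i (pbwS i x) = Function.update (pbwC i x) i (-⁅x i, x (i+1)⁆) := by
  funext j; simp only [pbwS, pbwC, Function.update_apply, lie_skew]; grind

theorem pbwS_comm {i j : ℕ} (h : i + 1 < j) (x : ℕ → L) :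
    pbwS i (pbwS j x) = pbwS j (pbwS i x) := by
  funext t; simp only [pbwS]; grind

theorem pbwS_braid (i : ℕ) (x : ℕ → L) :
    pbwS i (pbwS (i+1) (pbwS i x)) = pbwS (i+1) (pbwS i (pbwS (i+1) x)) := by
  funext t; simp only [pbwS]; grind

theorem pbwC_S_far1 {i j : ℕ} (h : i + 1 < j) (x : ℕ → L) :
    pbwC j (pbwS i x) = pbwS i (pbwC j x) := by
  funext t; simp only [pbwS, pbwC]; grind

theorem pbwC_S_far2 {i j : ℕ} (h : i + 1 < j) (x : ℕ → L) :
    pbwC i (pbwS j x) = pbwS (j-1) (pbwC i x) := by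
  funext t; simp only [pbwS, pbwC]; grind

theorem pbwC_C_far {i j : ℕ} (h : i + 1 < j) (x : ℕ → L) :
    pbwC (j-1) (pbwC i x) = pbwC i (pbwC j x) := by
  funext t; simp only [pbwC]; grind

theorem pbw_b1 (i : ℕ) (x : ℕ → L) :
    pbwS i (pbwC i x) = pbwC (i+1) (pbwS i (pbwS (i+1) x)) := by
  funext t; simp only [pbwS, pbwC]; grind

theorem pbw_b2 (i : ℕ) (x : ℕ → L) :
    pbwS i (pbwC (i+1) (pbwS i x)) = pbwC i (pbwS (i+1) x) := by
  funext t; simp only [pbwS, pbwC]; grind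

theorem pbw_b3 (i : ℕ) (x : ℕ → L) :
    pbwS i (pbwC i (pbwS (i+1) (pbwS i x))) = pbwC (i+1) x := by
  funext t; simp only [pbwS, pbwC]; grind

theorem pbw_c1 (i : ℕ) (x : ℕ → L) :
    pbwC i (pbwC i x) = Function.update (pbwC i (pbwC i x)) i ⁅⁅x i, x (i+1)⁆, x (i+2)⁆ := by
  funext t; simp only [pbwC, Function.update_apply]; grind

theorem pbw_c2 (i : ℕ) (x : ℕ → L) :
    pbwC i (pbwC (i+1) (pbwS i x)) =
      Function.update (pbwC i (pbwC i x)) i ⁅x (i+1), ⁅x i, x (i+2)⁆⁆ := by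
  funext t; simp only [pbwC, pbwS, Function.update_apply]; grind

theorem pbw_c3 (i : ℕ) (x : ℕ → L) :
    pbwC i (pbwC i (pbwS (i+1) (pbwS i x))) =
      Function.update (pbwC i (pbwC i x)) i ⁅⁅x (i+1), x (i+2)⁆, x i⁆ := by
  funext t; simp only [pbwC, pbwS, Function.update_apply]; grind

/-- symmetrization -/
def pbwSym (K : Type*) {L M : Type*} [Field K] [LieRing L] [AddCommGroup M] [Module K M] (n : ℕ) :
    ((ℕ → L) → M) →ₗ[K] ((Fin n → L) → M) where
  toFun f := fun x => ∑ σ : Equiv.Perm (Fin n), f (pbwExt n (x ∘ σ))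
  map_add' f g := by funext x; simp [Finset.sum_add_distrib]
  map_smul' c f := by funext x; simp [Finset.smul_sum]

theorem pbwSym_S (n i : ℕ) (hi : i + 1 < n) (f : (ℕ → L) → M) :
    pbwSym K n (fun x => f (pbwS i x)) = pbwSym K n f := by
  funext x
  simp only [pbwSym, LinearMap.coe_mk, AddHom.coe_mk]
  refine Fintype.sum_equiv (Equiv.mulRight (Equiv.swap ⟨i, by omega⟩ ⟨i+1, hi⟩)) _ _ ?_
  intro σ
  congr 1
  funext j
  simp only [pbwS, pbwExt, Function.comp, Equiv.coe_mulRight, Equiv.Perm.mul_apply,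
    Equiv.swap_apply_def, Fin.mk.injEq]
  by_cases h1 : j = i
  · subst h1; simp [hi, show j < n by omega]
  · by_cases h2 : j = i + 1
    · subst h2; simp [hi, show i < n by omega]
    · simp [h1, h2]

/-- the linearized affine operator -/
def pbwT (K : Type*) {L M : Type*} [Field K] [LieRing L] [AddCommGroup M] [Module K M]
    (Φ : (ℕ → L) → M) (i : ℕ) : (((ℕ → L) → M) × K) →ₗ[K] (((ℕ → L) → M) × K) where
  toFun p := (fun x => p.1 (pbwS i x) + p.2 • Φ (pbwC i x), p.2)
  map_add' p q := by
    ext x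
    · simp [add_smul]; abel
    · simp
  map_smul' c p := by
    ext x
    · simp [smul_smul]
    · simp

theorem pbw_neg {n : ℕ} {Φ : (ℕ → L) → M} (hΦ : Φ ∈ pbwML K L M n) {i : ℕ} (hi : i < n)
    (x : ℕ → L) : Φ (pbwC i (pbwS i x)) = - Φ (pbwC i x) := by
  have h := hΦ.2.2 (pbwC i x) i hi (-1) ⁅x i, x (i+1)⁆
  rw [pbwC_S]
  rw [neg_one_smul, neg_one_smul] at h
  rw [h]
  congr 2
  funext j; simp only [pbwC, Function.update_apply]; grind

theorem pbwC_mem {n : ℕ} {Φ : (ℕ → L) → M} (hΦ : Φ ∈ pbwML K L M n) {i : ℕ} (hi : i < n) :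
    (fun x => Φ (pbwC i x)) ∈ pbwML K L M (n+1) := by
  refine ⟨fun x y h => ?_, fun x j hj u v => ?_, fun x j hj c u => ?_⟩
  · apply hΦ.1
    intro j hj
    simp only [pbwC, h j (by omega), h (j+1) (by omega), h i (by omega), h (i+1) (by omega)]
  · rcases lt_trichotomy j i with h | h | h
    · have e : ∀ w, pbwC i (Function.update x j w) = Function.update (pbwC i x) j w := by
        intro w; funext t; simp only [pbwC, Function.update_apply]; grind
      simp only [e, hΦ.2.1 _ j (by omega)]
    · have e : ∀ w, pbwC i (Function.update x j w) = Function.update (pbwC i x) i ⁅w, x (i+1)⁆ := by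
        intro w; funext t; simp only [pbwC, Function.update_apply]; grind
      simp only [e, add_lie, hΦ.2.1 _ i hi]
    · by_cases h' : j = i + 1
      · have e : ∀ w, pbwC i (Function.update x j w) = Function.update (pbwC i x) i ⁅x i, w⁆ := by
          intro w; funext t; simp only [pbwC, Function.update_apply]; grind
        simp only [e, lie_add, hΦ.2.1 _ i hi]
      · have e : ∀ w, pbwC i (Function.update x j w) = Function.update (pbwC i x) (j-1) w := by
          intro w; funext t; simp only [pbwC, Function.update_apply]; grind
        simp only [e, hΦ.2.1 _ (j-1) (by omega)]
  · rcases lt_trichotomy j i with h | h | h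
    · have e : ∀ w, pbwC i (Function.update x j w) = Function.update (pbwC i x) j w := by
        intro w; funext t; simp only [pbwC, Function.update_apply]; grind
      simp only [e, hΦ.2.2 _ j (by omega)]
    · have e : ∀ w, pbwC i (Function.update x j w) = Function.update (pbwC i x) i ⁅w, x (i+1)⁆ := by
        intro w; funext t; simp only [pbwC, Function.update_apply]; grind
      simp only [e, smul_lie, hΦ.2.2 _ i hi]
    · by_cases h' : j = i + 1
      · have e : ∀ w, pbwC i (Function.update x j w) = Function.update (pbwC i x) i ⁅x i, w⁆ := by
          intro w; funext t; simp only [pbwC, Function.update_apply]; grind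
        simp only [e, lie_smul, hΦ.2.2 _ i hi]
      · have e : ∀ w, pbwC i (Function.update x j w) = Function.update (pbwC i x) (j-1) w := by
          intro w; funext t; simp only [pbwC, Function.update_apply]; grind
        simp only [e, hΦ.2.2 _ (j-1) (by omega)]

theorem pbwS_mem {n : ℕ} {Φ : (ℕ → L) → M} (hΦ : Φ ∈ pbwML K L M n) {i : ℕ} (hi : i + 1 < n) :
    (fun x => Φ (pbwS i x)) ∈ pbwML K L M n := by
  have e : ∀ x j (w : L), pbwS i (Function.update x j w) =
      Function.update (pbwS i x) (if j = i then i + 1 else if j = i + 1 then i else j) w := by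
    intro x j w; funext t; simp only [pbwS, Function.update_apply]; grind
  refine ⟨fun x y h => ?_, fun x j hj u v => ?_, fun x j hj c u => ?_⟩
  · apply hΦ.1
    intro j hj
    simp only [pbwS, h j (by omega), h i (by omega), h (i+1) (by omega)]
  · simp only [e]; rw [hΦ.2.1 _ _ (by split_ifs <;> omega)]
  · simp only [e]; rw [hΦ.2.2 _ _ (by split_ifs <;> omega)]

theorem pbw_step (n : ℕ) (Φ' Φ q : (ℕ → L) → M) (hΦ' : Φ' ∈ pbwML K L M (n-1))
    (hΦ : Φ ∈ pbwML K L M n)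
    (hR : ∀ i, i + 1 < n → ∀ x, Φ x - Φ (pbwS i x) = Φ' (pbwC i x))
    (hq : q ∈ pbwML K L M (n+1)) :
    ∃ f ∈ pbwML K L M (n+1),
      (∀ i, i + 1 < n + 1 → ∀ x, f x - f (pbwS i x) = Φ (pbwC i x)) ∧
      pbwSym K (n+1) f = pbwSym K (n+1) q := by
  obtain ⟨⟨f, r⟩, hfix, hP, hK⟩ := pbw_avg (k := K) (pbwT K Φ) n
    (by
      rintro i hi ⟨f, r⟩
      ext x
      · simp only [pbwT, LinearMap.coe_mk, AddHom.coe_mk, pbwS_S, pbw_neg hΦ hi]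
        simp
      · rfl)
    (by
      rintro i hi ⟨f, r⟩
      ext x
      · simp only [pbwT, LinearMap.coe_mk, AddHom.coe_mk, pbwS_braid, add_assoc, ← smul_add]
        congr 2
        have a1 := hR i hi (pbwC i x)
        have a2 := hR i hi (pbwC (i+1) (pbwS i x))
        have a3 := hR i hi (pbwC i (pbwS (i+1) (pbwS i x)))
        rw [pbw_b1, pbw_c1] at a1
        rw [pbw_b2, pbw_c2] at a2
        rw [pbw_b3, pbw_c3] at a3
        have hl : i < n - 1 := by omega
        have add := hΦ'.2.1 (pbwC i (pbwC i x)) i hl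
        have z0 : Φ' (Function.update (pbwC i (pbwC i x)) i 0) = 0 := by
          have := hΦ'.2.2 (pbwC i (pbwC i x)) i hl 0 0
          simpa using this
        have jac : ⁅⁅x i, x (i+1)⁆, x (i+2)⁆ + ⁅x (i+1), ⁅x i, x (i+2)⁆⁆
            + ⁅⁅x (i+1), x (i+2)⁆, x i⁆ = 0 := by
          rw [lie_lie, ← lie_skew ⁅x (i+1), x (i+2)⁆ (x i)]; abel
        rw [← jac, add, add, ← a1, ← a2, ← a3] at z0
        rw [← sub_eq_zero, ← z0]
        abel
      · rfl)
    (by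
      rintro i j hij hj ⟨f, r⟩
      ext x
      · simp only [pbwT, LinearMap.coe_mk, AddHom.coe_mk, pbwS_comm hij, add_assoc, ← smul_add]
        congr 2
        have a1 := hR i (by omega) (pbwC j x)
        have a2 := hR (j-1) (by omega) (pbwC i x)
        rw [← pbwC_S_far1 hij] at a1
        rw [← pbwC_S_far2 hij, pbwC_C_far hij, ← a1] at a2
        rw [← sub_eq_zero] at a2 ⊢
        rw [← a2]
        abel
      · rfl) (q, 1) n le_rfl
  have hinv : ∀ S : Submodule K (((ℕ → L) → M) × K),
      (∀ i, i < n → ∀ p, pbwT K Φ i p - p ∈ S) → (f, r) - (q, 1) ∈ S := by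
    intro S hS
    refine Submodule.span_le.2 ?_ hK
    rintro _ ⟨i, hi, p, rfl⟩
    exact hS i hi p
  have hr : r = 1 := by
    have := hinv (LinearMap.ker (LinearMap.snd K ((ℕ → L) → M) K)) (fun i hi p => by
      simp [pbwT])
    simpa [sub_eq_zero] using this
  subst hr
  refine ⟨f, ?_, ?_, ?_⟩
  · refine hP ((pbwML K L M (n+1)).comap (LinearMap.fst K _ K)) ?_ hq
    rintro i hi ⟨g, r⟩ hg
    exact Submodule.add_mem _ (pbwS_mem (show g ∈ _ from hg) (by omega))
      (Submodule.smul_mem _ r (pbwC_mem hΦ hi))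
  · intro i hi x
    have := congrFun (congrArg Prod.fst (hfix i (by omega))) x
    simp only [pbwT, LinearMap.coe_mk, AddHom.coe_mk, one_smul] at this
    rw [← this, add_sub_cancel_left]
  · have key := hinv (LinearMap.ker ((pbwSym K (n+1)).comp (LinearMap.fst K ((ℕ → L) → M) K))) ?_
    · simpa [sub_eq_zero] using key
    rintro i hi ⟨g, r⟩
    have h0 : pbwSym K (n+1) (fun x => Φ (pbwC i x)) = 0 := by
      have h := pbwSym_S (K := K) (n+1) i (by omega) (fun x => Φ (pbwC i x))
      have e : (fun x => Φ (pbwC i (pbwS i x))) = -(fun x => Φ (pbwC i x)) := by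
        funext x; exact pbw_neg hΦ hi x
      rw [e, map_neg] at h
      have h2 : (2 : K) • pbwSym K (n+1) (fun x => Φ (pbwC i x)) = 0 := by
        rw [two_smul]; nth_rewrite 1 [← h]; simp
      exact (smul_eq_zero.1 h2).resolve_left two_ne_zero
    have e : ((pbwT K Φ i (g, r)).1) = (fun x => g (pbwS i x)) + r • (fun x => Φ (pbwC i x)) := rfl
    rw [LinearMap.mem_ker, map_sub, sub_eq_zero]
    simp only [LinearMap.comp_apply, LinearMap.fst_apply]
    rw [e, map_add, map_smul, h0, pbwSym_S _ _ (by omega), smul_zero, add_zero]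
end pbwstep

section pbwmain
set_option linter.unusedSectionVars false
attribute [local instance] LieRing.ofAssociativeRing
variable {K L M : Type*} [Field K] [CharZero K] [LieRing L] [LieAlgebra K L]
  [AddCommGroup M] [Module K M]

theorem pbw_seq (q : ℕ → (ℕ → L) → M) (hq : ∀ n, q n ∈ pbwML K L M n) :
    ∃ φ : ℕ → (ℕ → L) → M, (∀ n, φ n ∈ pbwML K L M n) ∧
      (∀ n i, i + 1 < n + 1 → ∀ x, φ (n+1) x - φ (n+1) (pbwS i x) = φ n (pbwC i x)) ∧
      ∀ n, pbwSym K n (φ n) = pbwSym K n (q n) := by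
  let P : ℕ → ((ℕ → L) → M) × ((ℕ → L) → M) → Prop := fun n p =>
    p.1 ∈ pbwML K L M (n-1) ∧ p.2 ∈ pbwML K L M n ∧
      (∀ i, i + 1 < n → ∀ x, p.2 x - p.2 (pbwS i x) = p.1 (pbwC i x)) ∧
      pbwSym K n p.2 = pbwSym K n (q n)
  have step : ∀ n p, P n p → ∃ f, P (n+1) (p.2, f) := by
    rintro n ⟨Φ', Φ⟩ ⟨h1, h2, h3, h4⟩
    obtain ⟨f, f1, f2, f3⟩ := pbw_step n Φ' Φ (q (n+1)) h1 h2 h3 (hq _)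
    exact ⟨f, h2, f1, f2, f3⟩
  choose g hg using step
  let s : (n : ℕ) → {p // P n p} := fun n => Nat.rec
    ⟨(0, q 0), Submodule.zero_mem _, hq 0, fun i hi => absurd hi (Nat.not_lt_zero _), rfl⟩
    (fun n p => ⟨(p.1.2, g n p.1 p.2), hg n p.1 p.2⟩) n
  refine ⟨fun n => (s n).1.2, fun n => (s n).2.2.1, fun n i hi x => ?_, fun n => (s n).2.2.2.2⟩
  exact (s (n+1)).2.2.2.1 i hi x

/-- functions on lists which factor through the enveloping algebra -/
def pbwN (K L M : Type*) [Field K] [LieRing L] [LieAlgebra K L]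
    [AddCommGroup M] [Module K M] : Submodule K (List L → M) where
  carrier := {g | (∀ u v x y, g (u ++ (x + y) :: v) = g (u ++ x :: v) + g (u ++ y :: v)) ∧
    (∀ u v (c : K) x, g (u ++ (c • x) :: v) = c • g (u ++ x :: v)) ∧
    (∀ u v x y, g (u ++ ⁅x, y⁆ :: v) = g (u ++ x :: y :: v) - g (u ++ y :: x :: v))}
  zero_mem' := by simp
  add_mem' := by
    rintro f g ⟨h1, h2, h3⟩ ⟨h1', h2', h3'⟩
    refine ⟨fun u v x y => ?_, fun u v c x => ?_, fun u v x y => ?_⟩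
    · simp only [Pi.add_apply, h1, h1']; abel
    · simp only [Pi.add_apply, h2, h2', smul_add]
    · simp only [Pi.add_apply, h3, h3']; abel
  smul_mem' := by
    rintro r f ⟨h1, h2, h3⟩
    refine ⟨fun u v x y => ?_, fun u v c x => ?_, fun u v x y => ?_⟩
    · simp only [Pi.smul_apply, h1, smul_add]
    · simp only [Pi.smul_apply, h2, smul_comm r c]
    · simp only [Pi.smul_apply, h3, smul_sub]

/-- right translation by one letter -/
def pbwR (K L M : Type*) [Field K] [LieRing L] [LieAlgebra K L]
    [AddCommGroup M] [Module K M] (x : L) : pbwN K L M →ₗ[K] pbwN K L M where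
  toFun g := ⟨fun l => g.1 (l ++ [x]), by
    obtain ⟨g, h1, h2, h3⟩ := g
    refine ⟨fun u v y z => ?_, fun u v c y => ?_, fun u v y z => ?_⟩
    · simpa using h1 u (v ++ [x]) y z
    · simpa using h2 u (v ++ [x]) c y
    · simpa using h3 u (v ++ [x]) y z⟩
  map_add' f g := rfl
  map_smul' c f := rfl

/-- the right translation representation -/
def pbwRep (K L M : Type*) [Field K] [LieRing L] [LieAlgebra K L]
    [AddCommGroup M] [Module K M] : L →ₗ⁅K⁆ Module.End K (pbwN K L M) where
  toFun x := pbwR K L M x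
  map_add' x y := by
    ext g l
    exact g.2.1 l [] x y
  map_smul' c x := by
    ext g l
    exact g.2.2.1 l [] c x
  map_lie' := by
    intro x y
    ext g l
    have := g.2.2.2 l [] x y
    rw [LieRing.of_associative_ring_bracket]
    simpa [pbwR] using this

theorem pbw_lift (g : List L → M) (hg : g ∈ pbwN K L M) :
    ∃ Ψ : UniversalEnvelopingAlgebra K L →ₗ[K] M,
      ∀ l : List L, Ψ (l.map (UniversalEnvelopingAlgebra.ι K)).prod = g l := by
  let A := UniversalEnvelopingAlgebra.lift K (pbwRep K L M)
  let ev : pbwN K L M →ₗ[K] M := (LinearMap.proj (R := K) (φ := fun _ : List L => M) []).comp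
    (pbwN K L M).subtype
  refine ⟨ev.comp ((LinearMap.applyₗ (R := K) (⟨g, hg⟩ : pbwN K L M)).comp A.toLinearMap), ?_⟩
  have key : ∀ (l l' : List L) (h : pbwN K L M),
      (A (l.map (UniversalEnvelopingAlgebra.ι K)).prod h).1 l' = h.1 (l' ++ l) := by
    intro l
    induction l with
    | nil => intro l' h; simp
    | cons x l ih =>
      intro l' h
      rw [List.map_cons, List.prod_cons, map_mul, Module.End.mul_apply,
        UniversalEnvelopingAlgebra.lift_ι_apply]
      change (A (l.map (UniversalEnvelopingAlgebra.ι K)).prod h).1 (l' ++ [x]) = _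
      rw [ih]; simp
  intro l
  exact key l [] ⟨g, hg⟩

theorem pbw_main (Q : (n : ℕ) → MultilinearMap K (fun _ : Fin n => L) M)
    (hQ : ∀ n (σ : Equiv.Perm (Fin n)) x, Q n (x ∘ σ) = Q n x) :
    ∃ Ψ : UniversalEnvelopingAlgebra K L →ₗ[K] M,
      ∀ n (x : Fin n → L), Ψ (((n.factorial : K)⁻¹) • ∑ σ : Equiv.Perm (Fin n),
        (List.ofFn fun i => UniversalEnvelopingAlgebra.ι K (x (σ i))).prod) = Q n x := by
  obtain ⟨φ, hML, hrel, hsym⟩ := pbw_seq (K := K) (fun n x => Q n (fun i => x i)) (by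
    intro n
    have e : ∀ (x : ℕ → L) j (hj : j < n) (w : L), (fun i : Fin n => (Function.update x j w : ℕ → L) (i : ℕ)) =
        Function.update (fun i : Fin n => x i) ⟨j, hj⟩ w := by
      intro x j hj w; funext i; simp [Function.update_apply, Fin.ext_iff]
    refine ⟨fun x y h => ?_, fun x j hj u v => ?_, fun x j hj c u => ?_⟩
    · exact congrArg _ (funext fun i : Fin n => h i i.2)
    · simp only [e _ _ hj]; exact (Q n).map_update_add _ _ _ _
    · simp only [e _ _ hj]; exact (Q n).map_update_smul _ _ _ _)
  have upd : ∀ (u v : List L) (x : L), (fun i => (u ++ x :: v).getD i 0) =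
      Function.update (fun i => (u ++ (0:L) :: v).getD i 0) u.length x := by
    intro u v x; funext i
    simp only [List.getD_eq_getElem?_getD, List.getElem?_append, Function.update_apply,
      List.getElem?_cons]
    grind
  obtain ⟨Ψ, hΨ⟩ := pbw_lift (K := K) (fun l : List L => φ l.length (fun i => l.getD i 0)) (by
    refine ⟨fun u v x y => ?_, fun u v c x => ?_, fun u v x y => ?_⟩
    · simp only [List.length_append, List.length_cons]
      rw [upd u v (x + y), upd u v x, upd u v y]
      exact (hML _).2.1 _ _ (by omega) _ _
    · simp only [List.length_append, List.length_cons]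
      rw [upd u v (c • x), upd u v x]
      exact (hML _).2.2 _ _ (by omega) _ _
    · simp only [List.length_append, List.length_cons]
      have := hrel (u.length + (v.length + 1)) u.length (by omega)
        (fun i => (u ++ x :: y :: v).getD i 0)
      have e1 : pbwS u.length (fun i => (u ++ x :: y :: v).getD i 0) =
          (fun i => (u ++ y :: x :: v).getD i 0) := by
        funext i
        simp only [pbwS, List.getD_eq_getElem?_getD, List.getElem?_append, List.getElem?_cons]
        grind
      have e2 : pbwC u.length (fun i => (u ++ x :: y :: v).getD i 0) =
          (fun i => (u ++ ⁅x, y⁆ :: v).getD i 0) := by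
        funext i
        simp only [pbwC, List.getD_eq_getElem?_getD, List.getElem?_append, List.getElem?_cons]
        grind
      rw [e1, e2] at this
      exact this.symm)
  refine ⟨Ψ, fun n x => ?_⟩
  have hn : (n.factorial : K) ≠ 0 := by exact_mod_cast n.factorial_ne_zero
  have h1 : ∀ z : Fin n → L, Ψ (List.ofFn fun i => UniversalEnvelopingAlgebra.ι K (z i)).prod
      = φ n (pbwExt n z) := by
    intro z
    have := hΨ (List.ofFn z)
    rw [List.map_ofFn, List.length_ofFn] at this
    refine this.trans ?_
    congr 1
    funext i
    simp only [pbwExt, List.getD_eq_getElem?_getD, List.getElem?_ofFn]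
    split_ifs <;> simp
  rw [map_smul, map_sum]
  have h2 := congrFun (hsym n) x
  simp only [pbwSym, LinearMap.coe_mk, AddHom.coe_mk] at h2
  have h3 : ∀ z : Fin n → L, (fun i : Fin n => pbwExt n z i) = z := by
    intro z; funext i; simp [pbwExt]
  simp only [h3, hQ] at h2
  rw [Finset.sum_const, Finset.card_univ, Fintype.card_perm, Fintype.card_fin,
    ← Nat.cast_smul_eq_nsmul K] at h2
  rw [inv_smul_eq_iff₀ hn, ← h2]
  exact Finset.sum_congr rfl fun σ _ => h1 (x ∘ σ)
end pbwmain

section pbwbeta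
set_option linter.unusedSectionVars false
attribute [local instance] LieRing.ofAssociativeRing
variable (K L : Type*) [Field K] [CharZero K] [LieRing L] [LieAlgebra K L]

/-- product of the images in the enveloping algebra, as a multilinear map -/
def pbwProd (n : ℕ) :
    MultilinearMap K (fun _ : Fin n => L) (UniversalEnvelopingAlgebra K L) :=
  (MultilinearMap.mkPiAlgebraFin K n (UniversalEnvelopingAlgebra K L)).compLinearMap
    (fun _ => (UniversalEnvelopingAlgebra.ι K : L →ₗ⁅K⁆ UniversalEnvelopingAlgebra K L).toLinearMap)

/-- symmetrization as a multilinear map -/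
def pbwBeta (n : ℕ) :
    MultilinearMap K (fun _ : Fin n => L) (UniversalEnvelopingAlgebra K L) :=
  ((n.factorial : K)⁻¹) • ∑ σ : Equiv.Perm (Fin n), (pbwProd K L n).domDomCongr σ

theorem pbwProd_apply (n : ℕ) (x : Fin n → L) :
    pbwProd K L n x = (List.ofFn fun i => UniversalEnvelopingAlgebra.ι K (x i)).prod := rfl

theorem pbwBeta_apply' (n : ℕ) (x : Fin n → L) :
    pbwBeta K L n x = ((n.factorial : K)⁻¹) • ∑ σ : Equiv.Perm (Fin n),
      pbwProd K L n (x ∘ σ) := by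
  simp only [pbwBeta, smul_apply, sum_apply,
    MultilinearMap.domDomCongr_apply]
  rfl

theorem pbwBeta_apply (n : ℕ) (x : Fin n → L) :
    pbwBeta K L n x = ((n.factorial : K)⁻¹) • ∑ σ : Equiv.Perm (Fin n),
      (List.ofFn fun i => UniversalEnvelopingAlgebra.ι K (x (σ i))).prod :=
  pbwBeta_apply' K L n x

theorem pbwBeta_perm (n : ℕ) (σ : Equiv.Perm (Fin n)) (x : Fin n → L) :
    pbwBeta K L n (x ∘ σ) = pbwBeta K L n x := by
  rw [pbwBeta_apply', pbwBeta_apply']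
  congr 1
  exact Fintype.sum_equiv (Equiv.mulLeft σ) _ _ (fun τ => rfl)

theorem pbwProd_cons (n : ℕ) (x : Fin (n+1) → L) :
    pbwProd K L (n+1) x = UniversalEnvelopingAlgebra.ι K (x 0) *
      pbwProd K L n (fun i => x i.succ) := by
  rw [pbwProd_apply, List.ofFn_succ, List.prod_cons]; rfl

theorem pbwProd_ad (n : ℕ) (y : L) (x : Fin n → L) :
    ∑ j : Fin n, pbwProd K L n (Function.update x j ⁅y, x j⁆) =
      UniversalEnvelopingAlgebra.ι K y * pbwProd K L n x
        - pbwProd K L n x * UniversalEnvelopingAlgebra.ι K y := by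
  induction n with
  | zero => simp [pbwProd_apply]
  | succ n ih =>
    have e : ∀ j : Fin n, pbwProd K L (n+1) (Function.update x j.succ ⁅y, x j.succ⁆) =
        UniversalEnvelopingAlgebra.ι K (x 0) *
          pbwProd K L n (Function.update (fun i => x i.succ) j ⁅y, x j.succ⁆) := by
      intro j
      rw [pbwProd_cons]
      congr 2
      funext i
      simp [Function.update_apply]
    rw [Fin.sum_univ_succ]
    simp only [e]
    rw [← Finset.mul_sum, ih (fun i => x i.succ), pbwProd_cons, pbwProd_cons]
    have e0 : (fun i : Fin n => Function.update x 0 ⁅y, x 0⁆ i.succ) = fun i => x i.succ := by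
      funext i; simp
    rw [e0, Function.update_self, LieHom.map_lie, LieRing.of_associative_ring_bracket]
    noncomm_ring

theorem pbwBeta_ad (n : ℕ) (y : L) (x : Fin n → L) :
    ∑ j : Fin n, pbwBeta K L n (Function.update x j ⁅y, x j⁆) =
      UniversalEnvelopingAlgebra.ι K y * pbwBeta K L n x
        - pbwBeta K L n x * UniversalEnvelopingAlgebra.ι K y := by
  simp only [pbwBeta_apply']
  rw [← Finset.smul_sum, Finset.sum_comm, mul_smul_comm, smul_mul_assoc, ← smul_sub,
    Finset.mul_sum, Finset.sum_mul, ← Finset.sum_sub_distrib]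
  congr 1
  refine Finset.sum_congr rfl fun σ _ => ?_
  rw [← pbwProd_ad]
  refine Fintype.sum_equiv σ.symm _ _ fun j => ?_
  congr 1
  funext i
  simp [Function.update_apply, Equiv.eq_symm_apply]

/-- the range of symmetrization -/
def pbwB : Submodule K (UniversalEnvelopingAlgebra K L) :=
  Submodule.span K {z | ∃ n x, z = pbwBeta K L n x}

theorem pbwB_list (n : ℕ) : ∀ l : List L, l.length = n →
    (l.map (UniversalEnvelopingAlgebra.ι K)).prod ∈ pbwB K L := by
  induction n using Nat.strong_induction_on with
  | _ n ih =>
  have hperm : ∀ l l' : List L, l.Perm l' → ∀ u : List L, u.length + l.length = n →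
      ((u ++ l).map (UniversalEnvelopingAlgebra.ι K)).prod -
        ((u ++ l').map (UniversalEnvelopingAlgebra.ι K)).prod ∈ pbwB K L := by
    intro l l' h
    induction h with
    | nil => intro u _; simp
    | cons x _ ihp =>
      intro u hu
      have := ihp (u ++ [x]) (by simp at hu ⊢; omega)
      simpa using this
    | swap x y v =>
      intro u hu
      have := ih (n-1) (by simp at hu; omega) (u ++ ⁅y, x⁆ :: v) (by simp at hu ⊢; omega)
      convert this using 1
      simp only [List.map_append, List.map_cons, List.prod_append, List.prod_cons,
        LieHom.map_lie, LieRing.of_associative_ring_bracket]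
      noncomm_ring
    | trans h1 _ ih1 ih2 =>
      intro u hu
      have := Submodule.add_mem _ (ih1 u hu) (ih2 u (by rw [← h1.length_eq]; exact hu))
      simpa using this
  intro l hl
  subst hl
  have hn : (l.length.factorial : K) ≠ 0 := by exact_mod_cast l.length.factorial_ne_zero
  have e : (l.map (UniversalEnvelopingAlgebra.ι K)).prod =
      pbwBeta K L l.length l.get + ((l.length.factorial : K)⁻¹) •
        ∑ σ : Equiv.Perm (Fin l.length), ((l.map (UniversalEnvelopingAlgebra.ι K)).prod -
          pbwProd K L l.length (l.get ∘ σ)) := by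
    rw [Finset.sum_sub_distrib, smul_sub, ← pbwBeta_apply', Finset.sum_const, Finset.card_univ,
      Fintype.card_perm, Fintype.card_fin, ← Nat.cast_smul_eq_nsmul K, smul_smul,
      inv_mul_cancel₀ hn, one_smul]
    abel
  rw [e]
  refine Submodule.add_mem _ (Submodule.subset_span ⟨_, _, rfl⟩)
    (Submodule.smul_mem _ _ (Submodule.sum_mem _ fun σ _ => ?_))
  have hp : l.Perm (List.ofFn (l.get ∘ σ)) := by
    have := (Equiv.Perm.ofFn_comp_perm σ l.get).symm
    rwa [List.ofFn_get] at this
  have := hperm l _ hp [] (by simp)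
  rw [List.nil_append, List.nil_append, List.map_ofFn] at this
  exact this

theorem pbw_induction (P : UniversalEnvelopingAlgebra K L → Prop)
    (h0 : ∀ c : K, P (algebraMap K _ c)) (h1 : ∀ x, P (UniversalEnvelopingAlgebra.ι K x))
    (h2 : ∀ u v, P u → P v → P (u + v)) (h3 : ∀ u v, P u → P v → P (u * v)) (u) : P u := by
  let S : Subalgebra K (UniversalEnvelopingAlgebra K L) :=
    { carrier := {u | P u}
      mul_mem' := fun {a b} ha hb => h3 a b ha hb
      add_mem' := fun {a b} ha hb => h2 a b ha hb
      algebraMap_mem' := h0 }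
  let f : L →ₗ⁅K⁆ S :=
    { toFun := fun x => ⟨UniversalEnvelopingAlgebra.ι K x, h1 x⟩
      map_add' := fun x y => by ext; simp
      map_smul' := fun c x => by ext; simp
      map_lie' := fun {x y} => by
        ext
        simp [LieRing.of_associative_ring_bracket] }
  have : S.val.comp (UniversalEnvelopingAlgebra.lift K f) = AlgHom.id K _ := by
    apply UniversalEnvelopingAlgebra.hom_ext
    ext x
    change ((UniversalEnvelopingAlgebra.lift K f (UniversalEnvelopingAlgebra.ι K x) : S) :
      UniversalEnvelopingAlgebra K L) = UniversalEnvelopingAlgebra.ι K x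
    rw [UniversalEnvelopingAlgebra.lift_ι_apply]
    rfl
  have h := DFunLike.congr_fun this u
  have h' : ((UniversalEnvelopingAlgebra.lift K f u : S) : UniversalEnvelopingAlgebra K L) = u := h
  rw [← h']
  exact (UniversalEnvelopingAlgebra.lift K f u).2

theorem pbwB_top (u : UniversalEnvelopingAlgebra K L) : u ∈ pbwB K L := by
  have key : ∀ u : UniversalEnvelopingAlgebra K L,
      u ∈ Submodule.span K {z | ∃ l : List L, z = (l.map (UniversalEnvelopingAlgebra.ι K)).prod} := by
    apply pbw_induction
    · intro c
      rw [Algebra.algebraMap_eq_smul_one]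
      exact Submodule.smul_mem _ _ (Submodule.subset_span ⟨[], by simp⟩)
    · intro x
      exact Submodule.subset_span ⟨[x], by simp⟩
    · intro u v hu hv
      exact Submodule.add_mem _ hu hv
    · intro u v hu hv
      have := Submodule.mul_mem_mul hu hv
      rw [Submodule.span_mul_span] at this
      refine Submodule.span_mono ?_ this
      rintro _ ⟨_, ⟨l, rfl⟩, _, ⟨l', rfl⟩, rfl⟩
      exact ⟨l ++ l', by simp⟩
  refine Submodule.span_le.2 ?_ (key u)
  rintro _ ⟨l, rfl⟩
  exact pbwB_list K L _ l rfl
end pbwbeta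

/-- the universal symmetric multilinear map, reduced and in all degrees -/
def pbwQ (n : ℕ) : MultilinearMap k (fun _ : Fin n => a)
    (⨁ d : {d : ℕ // 1 ≤ d}, LambdaD k a d.1) :=
  if h : 1 ≤ n then
    ((DirectSum.lof k _ (fun d : {d : ℕ // 1 ≤ d} => LambdaD k a d.1) ⟨n, h⟩).comp
      ((adSub k a n).mkQ.comp (symPowRel k a n).mkQ)).compMultilinearMap (PiTensorProduct.tprod k)
  else 0

theorem pbwQ_apply (d : {d : ℕ // 1 ≤ d}) (x : Fin d.1 → a) :
    pbwQ k a d.1 x = DirectSum.of (fun d : {d : ℕ // 1 ≤ d} => LambdaD k a d.1) d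
      (Submodule.Quotient.mk (Submodule.Quotient.mk (PiTensorProduct.tprod k x))) := by
  rw [pbwQ, dif_pos d.2]; rfl

theorem pbwQ_perm (n : ℕ) (σ : Equiv.Perm (Fin n)) (x : Fin n → a) :
    pbwQ k a n (x ∘ σ) = pbwQ k a n x := by
  by_cases h : 1 ≤ n
  · rw [pbwQ_apply k a ⟨n, h⟩, pbwQ_apply k a ⟨n, h⟩]
    congr 2
    symm
    rw [Submodule.Quotient.eq]
    exact Submodule.subset_span ⟨x, σ, rfl⟩
  · rw [pbwQ, dif_neg h]; rfl

theorem pbwQ_ad (n : ℕ) (y : a) (x : Fin n → a) :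
    ∑ j : Fin n, pbwQ k a n (Function.update x j ⁅y, x j⁆) = 0 := by
  by_cases h : 1 ≤ n
  · have : (symPowRel k a n).mkQ
        (∑ j : Fin n, PiTensorProduct.tprod k (Function.update x j ⁅y, x j⁆)) ∈ adSub k a n :=
      Submodule.subset_span ⟨y, x, rfl⟩
    have h2 := (Submodule.Quotient.mk_eq_zero _).2 this
    have h3 := congrArg (DirectSum.lof k _ (fun d : {d : ℕ // 1 ≤ d} => LambdaD k a d.1) ⟨n, h⟩) h2
    rw [map_zero, ← Submodule.mkQ_apply, map_sum, map_sum, map_sum] at h3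
    rw [← h3]
    refine Finset.sum_congr rfl fun j _ => ?_
    rw [pbwQ_apply k a ⟨n, h⟩]; rfl
  · simp [pbwQ, dif_neg h]

/-- symmetrization on the coinvariants -/
def pbwLam (n : ℕ) : LambdaD k a n →ₗ[k] RedCyc k a :=
  (adSub k a n).liftQ ((symPowRel k a n).liftQ
    ((redCycRel k a).mkQ.comp (PiTensorProduct.lift (pbwBeta k a n)))
    (by
      refine Submodule.span_le.2 ?_
      rintro _ ⟨x, σ, rfl⟩
      simp only [SetLike.mem_coe, LinearMap.mem_ker, LinearMap.comp_apply, map_sub,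
        PiTensorProduct.lift.tprod]
      rw [pbwBeta_perm, sub_self]))
    (by
      refine Submodule.span_le.2 ?_
      rintro _ ⟨y, x, rfl⟩
      simp only [SetLike.mem_coe, LinearMap.mem_ker]
      change (redCycRel k a).mkQ (PiTensorProduct.lift (pbwBeta k a n)
        (∑ j : Fin n, PiTensorProduct.tprod k (Function.update x j ⁅y, x j⁆))) = 0
      rw [map_sum]
      simp only [PiTensorProduct.lift.tprod]
      rw [pbwBeta_ad, Submodule.mkQ_apply, Submodule.Quotient.mk_eq_zero]
      exact Submodule.subset_span (Or.inr ⟨_, _, rfl⟩))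

/-- the symmetrization map on the direct sum -/
def pbwE : (⨁ d : {d : ℕ // 1 ≤ d}, LambdaD k a d.1) →ₗ[k] RedCyc k a :=
  DirectSum.toModule k _ _ (fun d => pbwLam k a d.1)

theorem pbwE_Q (d : {d : ℕ // 1 ≤ d}) (x : Fin d.1 → a) :
    pbwE k a (pbwQ k a d.1 x) = Submodule.Quotient.mk (pbwBeta k a d.1 x) := by
  rw [pbwQ_apply, ← DirectSum.lof_eq_of k, pbwE, DirectSum.toModule_lof]
  change (redCycRel k a).mkQ (PiTensorProduct.lift (pbwBeta k a d.1) (PiTensorProduct.tprod k x)) = _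
  rw [PiTensorProduct.lift.tprod]; rfl

theorem pbw_inverse : ∃ Ψ : RedCyc k a →ₗ[k] (⨁ d : {d : ℕ // 1 ≤ d}, LambdaD k a d.1),
    ∀ n x, Ψ (Submodule.Quotient.mk (pbwBeta k a n x)) = pbwQ k a n x := by
  letI : AddCommGroup (⨁ d : {d : ℕ // 1 ≤ d}, LambdaD k a d.1) :=
    Module.addCommMonoidToAddCommGroup k
  obtain ⟨Ψ, hΨ⟩ := pbw_main (K := k) (L := a)
    (M := ⨁ d : {d : ℕ // 1 ≤ d}, LambdaD k a d.1) (pbwQ k a) (pbwQ_perm k a)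
  simp only [← pbwBeta_apply] at hΨ
  have hy : ∀ (y : a) (v : UniversalEnvelopingAlgebra k a),
      Ψ (UniversalEnvelopingAlgebra.ι k y * v - v * UniversalEnvelopingAlgebra.ι k y) = 0 := by
    intro y v
    have hv := pbwB_top k a v
    rw [pbwB] at hv
    induction hv using Submodule.span_induction with
    | mem z hz =>
      obtain ⟨n, x, rfl⟩ := hz
      rw [← pbwBeta_ad, map_sum]
      simp only [hΨ]
      exact pbwQ_ad k a n y x
    | zero => simp
    | add u v _ _ hu hv =>
      rw [mul_add, add_mul, add_sub_add_comm, map_add, hu, hv, add_zero]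
    | smul c u _ hu =>
      rw [mul_smul_comm, smul_mul_assoc, ← smul_sub]
      exact (LinearMap.ker Ψ).smul_mem c hu
  have huv : ∀ u v : UniversalEnvelopingAlgebra k a, Ψ (u * v - v * u) = 0 := by
    apply pbw_induction
    · intro c v
      rw [Algebra.commutes, sub_self, map_zero]
    · exact hy
    · intro u u' h h' v
      rw [mul_add, add_mul, add_sub_add_comm, map_add, h, h', add_zero]
    · intro u u' h h' v
      have : u * u' * v - v * (u * u') = (u * (u' * v) - (u' * v) * u) +
          (u' * (v * u) - (v * u) * u') := by noncomm_ring
      rw [this, map_add, h, h', add_zero]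
  refine ⟨(redCycRel k a).liftQ Ψ ?_, fun n x => ?_⟩
  · refine Submodule.span_le.2 ?_
    rintro z (rfl | ⟨u, v, rfl⟩)
    · have h := hΨ 0 (fun i => i.elim0)
      have e : pbwBeta k a 0 (fun i => i.elim0) = 1 := by
        simp [pbwBeta_apply]
      rw [e] at h
      rw [SetLike.mem_coe, LinearMap.mem_ker, h]
      simp [pbwQ]
    · exact huv u v
  · exact hΨ n x

/-- STATEMENT 8: the symmetrization map `β : Sym(𝔞) → U𝔞`,
`x₁⋯x_d ↦ (1/d!) Σ_{σ ∈ S_d} x_{σ(1)}⋯x_{σ(d)}`, descends to the indicated quotients and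
induces a `k`-linear isomorphism `⊕_{d≥1} λ^(d)(𝔞) ≅ U𝔞/(k·1 + [U𝔞, U𝔞])` — the Lie–Hodge
decomposition of the reduced cyclic space of `U𝔞`. -/
theorem lie_hodge_decomposition :
    ∃ e : (⨁ d : {d : ℕ // 1 ≤ d}, LambdaD k a d.1) ≃ₗ[k] RedCyc k a,
      ∀ (d : {d : ℕ // 1 ≤ d}) (x : Fin d.1 → a),
        e (DirectSum.of (fun d : {d : ℕ // 1 ≤ d} => LambdaD k a d.1) d
            (Submodule.Quotient.mk (Submodule.Quotient.mk (PiTensorProduct.tprod k x))))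
          = Submodule.Quotient.mk
              ((((d.1).factorial : k)⁻¹) •
                ∑ σ : Equiv.Perm (Fin d.1),
                  (List.ofFn fun i => UniversalEnvelopingAlgebra.ι k (x (σ i))).prod) := by
  obtain ⟨Ψ, hΨ⟩ := pbw_inverse k a
  have h1 : (pbwE k a).comp Ψ = LinearMap.id := by
    apply LinearMap.ext
    intro z
    obtain ⟨u, rfl⟩ := Submodule.Quotient.mk_surjective _ z
    have hu := pbwB_top k a u
    rw [pbwB] at hu
    induction hu using Submodule.span_induction with
    | mem z hz =>
      obtain ⟨n, x, rfl⟩ := hz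
      rw [LinearMap.comp_apply, hΨ]
      by_cases h : 1 ≤ n
      · exact pbwE_Q k a ⟨n, h⟩ x
      · obtain rfl : n = 0 := by omega
        have e : pbwBeta k a 0 x = 1 := by simp [pbwBeta_apply]
        have e0 : pbwQ k a 0 x = 0 := by simp [pbwQ]
        rw [e0, map_zero, e, LinearMap.id_apply]
        symm
        rw [Submodule.Quotient.mk_eq_zero]
        exact Submodule.subset_span (Or.inl rfl)
    | zero => simp
    | add u v _ _ hu hv => rw [Submodule.Quotient.mk_add, map_add, map_add, hu, hv]
    | smul c u _ hu => rw [Submodule.Quotient.mk_smul, map_smul, map_smul, hu]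
  have h2 : Ψ.comp (pbwE k a) = LinearMap.id := by
    apply DirectSum.linearMap_ext
    intro d
    have key : ((Ψ.comp (pbwE k a)).comp
        (DirectSum.lof k _ (fun d : {d : ℕ // 1 ≤ d} => LambdaD k a d.1) d)).comp
          ((adSub k a d.1).mkQ.comp (symPowRel k a d.1).mkQ) =
        (DirectSum.lof k _ (fun d : {d : ℕ // 1 ≤ d} => LambdaD k a d.1) d).comp
          ((adSub k a d.1).mkQ.comp (symPowRel k a d.1).mkQ) := by
      apply PiTensorProduct.ext
      ext1 x
      have := pbwQ_apply k a d x
      change Ψ (pbwE k a (DirectSum.of (fun d : {d : ℕ // 1 ≤ d} => LambdaD k a d.1) d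
        (Submodule.Quotient.mk (Submodule.Quotient.mk (PiTensorProduct.tprod k x))))) =
        DirectSum.of (fun d : {d : ℕ // 1 ≤ d} => LambdaD k a d.1) d
        (Submodule.Quotient.mk (Submodule.Quotient.mk (PiTensorProduct.tprod k x)))
      rw [← this, pbwE_Q, hΨ]
    apply LinearMap.ext
    intro z
    obtain ⟨z, rfl⟩ := Submodule.Quotient.mk_surjective _ z
    obtain ⟨z, rfl⟩ := Submodule.Quotient.mk_surjective _ z
    exact DFunLike.congr_fun key z
  refine ⟨LinearEquiv.ofLinearMap (pbwE k a) Ψ h1 h2, fun d x => ?_⟩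
  rw [← pbwBeta_apply, ← pbwE_Q, pbwQ_apply]
  rfl

end
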